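/- arXiv:1307.3175 — 3 statements merged into one kernel-verified Lean document; each statement's English description precedes it below -/
import Mathlib

section
/- Every affine group scheme of finite type over a field of characteristic zero is reduced (equivalently, smooth over the base field). -/
open TensorProduct Coalgebra

/-- A derivation in characteristic zero preserves nilpotents. -/
theorem cartier_deriv_nilp {k A : Type*} [Field k] [CharZero k] [CommRing A] [Algebra k A]
    (D : Derivation k A A) {a : A} (ha : IsNilpotent a) : IsNilpotent (D a) := by
  have key : ∀ m j : ℕ, a ^ m * (D a) ^ j = 0 → IsNilpotent (D a) := by
    intro m
    induction m with
    | zero => intro j h; exact ⟨j, by simpa using h⟩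
    | succ m ih =>
      intro j h
      apply ih (j + 2)
      have h1 := congrArg D h
      rw [D.leibniz, D.leibniz_pow, D.leibniz_pow, map_zero] at h1
      simp only [smul_eq_mul, nsmul_eq_mul, Nat.add_sub_cancel] at h1
      have h2 : ((m + 1 : ℕ) : A) * (a ^ m * (D a) ^ (j + 2)) = 0 := by
        have h3 := congrArg (· * D a) h1
        simp only [zero_mul] at h3
        rcases j with _ | j
        · simp only [pow_zero, mul_one] at h h3 ⊢
          simp only [Nat.cast_zero, zero_mul, mul_zero, zero_add] at h3
          linear_combination h3
        · simp only [Nat.add_sub_cancel] at h3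
          linear_combination h3 - ((j + 1 : ℕ) : A) * D (D a) * h
      have h4 : ((m + 1 : ℕ) : k) • (a ^ m * (D a) ^ (j + 2)) = 0 := by
        rw [Algebra.smul_def, map_natCast]; exact h2
      exact (smul_eq_zero.mp h4).resolve_left (Nat.cast_ne_zero.mpr (Nat.succ_ne_zero m))
  obtain ⟨n, hn⟩ := ha
  exact key n 0 (by simpa using hn)

theorem cartier_euler {k A ι : Type*} [Field k] [CharZero k] [CommRing A] [Algebra k A]
    [Fintype ι] (m : Ideal A) [m.IsPrime] (x : ι → A) (hx : ∀ i, x i ∈ m)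
    (D : ι → Derivation k A A)
    (hD : ∀ z ∈ m, (∑ i, x i * D i z) - z ∈ m ^ 2) (n : ℕ) :
    ∀ y : A, IsNilpotent y → y ∈ m ^ n := by
  have hE : ∀ n : ℕ, ∀ y ∈ m ^ n, (∑ i, x i * D i y) - n * y ∈ m ^ (n + 1) := by
    intro n
    induction n with
    | zero =>
      intro y _
      simpa using Ideal.sum_mem _ fun i _ => m.mul_mem_right _ (hx i)
    | succ n ih =>
      intro y hy
      rw [pow_succ] at hy
      refine Submodule.mul_induction_on hy ?_ ?_
      · intro a ha b hb
        have e : (∑ i, x i * D i (a * b)) - ((n + 1 : ℕ) : A) * (a * b)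
            = ((∑ i, x i * D i a) - n * a) * b + a * ((∑ i, x i * D i b) - b) := by
          have : ∑ i, x i * D i (a * b) = (∑ i, x i * D i a) * b + a * ∑ i, x i * D i b := by
            rw [Finset.sum_mul, Finset.mul_sum, ← Finset.sum_add_distrib]
            refine Finset.sum_congr rfl fun i _ => ?_
            rw [Derivation.leibniz]; simp only [smul_eq_mul]; ring
          rw [this]; push_cast; ring
        rw [e]
        refine add_mem ?_ ?_
        · rw [pow_succ]; exact Ideal.mul_mem_mul (ih a ha) hb
        · rw [add_assoc, pow_add]; exact Ideal.mul_mem_mul ha (hD b hb)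
      · intro a b ha hb
        have e : (∑ i, x i * D i (a + b)) - ((n + 1 : ℕ) : A) * (a + b)
            = ((∑ i, x i * D i a) - ((n + 1 : ℕ) : A) * a)
              + ((∑ i, x i * D i b) - ((n + 1 : ℕ) : A) * b) := by
          simp only [map_add, mul_add, Finset.sum_add_distrib]; ring
        rw [e]; exact add_mem ha hb
  induction n with
  | zero => intro y _; simp
  | succ n ih =>
    intro y hy
    rcases Nat.eq_zero_or_pos n with rfl | hn
    · obtain ⟨r, hr⟩ := hy
      rw [zero_add, pow_one]
      exact Ideal.IsPrime.mem_of_pow_mem ‹_› r (by rw [hr]; exact m.zero_mem)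
    have h1 := hE n y (ih y hy)
    have h2 : ∑ i, x i * D i y ∈ m ^ (n + 1) := Ideal.sum_mem _ fun i _ => by
      rw [pow_succ']; exact Ideal.mul_mem_mul (hx i) (ih _ (cartier_deriv_nilp (D i) hy))
    have h3 : (n : A) * y ∈ m ^ (n + 1) := by
      have := sub_mem h2 h1
      simpa using this
    have h4 : y = algebraMap k A ((n : k)⁻¹) * ((n : A) * y) := by
      rw [← mul_assoc, ← map_natCast (algebraMap k A) n, ← map_mul,
        inv_mul_cancel₀ (Nat.cast_ne_zero.mpr hn.ne'), map_one, one_mul]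
    rw [h4]; exact Ideal.mul_mem_left _ _ h3

section
variable {k A : Type*} [Field k] [CommRing A] [HopfAlgebra k A]

/-- The map `id ⊗ d : A ⊗ A → A`. -/
noncomputable def cartierT (d : A →ₗ[k] k) : A ⊗[k] A →ₗ[k] A :=
  (TensorProduct.rid k A).toLinearMap ∘ₗ d.lTensor A

@[simp] theorem cartierT_tmul (d : A →ₗ[k] k) (a b : A) : cartierT d (a ⊗ₜ b) = d b • a := by
  simp [cartierT]

theorem cartierT_mul (d : A →ₗ[k] k)
    (hd : ∀ a b, d (a * b) = counit (R := k) a * d b + counit (R := k) b * d a)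
    (u v : A ⊗[k] A) : cartierT d (u * v) =
      cartierT counit u * cartierT d v + cartierT counit v * cartierT d u := by
  induction u with
  | zero => simp
  | add u₁ u₂ h₁ h₂ => rw [add_mul, map_add, h₁, h₂, map_add, map_add]; ring
  | tmul a b =>
    induction v with
    | zero => simp
    | add u₁ u₂ h₁ h₂ => rw [mul_add, map_add, h₁, h₂, map_add, map_add]; ring
    | tmul a' b' =>
      simp only [Algebra.TensorProduct.tmul_mul_tmul, cartierT_tmul, hd, Algebra.smul_def,
        map_add, map_mul]
      ring

theorem cartierT_counit (a : A) : cartierT (counit (R := k)) (comul a) = a := by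
  simp [cartierT]

theorem counit_cartierT (d : A →ₗ[k] k) (a : A) :
    counit (R := k) (cartierT d (comul a)) = d a := by
  have h : ∀ u : A ⊗[k] A, counit (R := k) (cartierT d u) =
      d (TensorProduct.lid k A ((counit (R := k)).rTensor A u)) := by
    intro u
    induction u with
    | zero => simp
    | add u v h₁ h₂ => simp only [map_add, h₁, h₂]
    | tmul a b => simp [mul_comm]
  rw [h]; simp

/-- The invariant derivation attached to a point derivation at the identity. -/
noncomputable def cartierD (d : A →ₗ[k] k)
    (hd : ∀ a b, d (a * b) = counit (R := k) a * d b + counit (R := k) b * d a) :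
    Derivation k A A :=
  Derivation.mk' (cartierT d ∘ₗ comul) (by
    intro a b
    simp only [LinearMap.comp_apply, Bialgebra.comul_mul, cartierT_mul d hd, cartierT_counit,
      smul_eq_mul])

theorem counit_cartierD (d : A →ₗ[k] k)
    (hd : ∀ a b, d (a * b) = counit (R := k) a * d b + counit (R := k) b * d a) (a : A) :
    counit (R := k) (cartierD d hd a) = d a := counit_cartierT d a

theorem cartier_at_one [CharZero k] (hft : Algebra.FiniteType k A) (n : ℕ) (y : A)
    (hy : IsNilpotent y) : y ∈ RingHom.ker (Bialgebra.counitAlgHom k A) ^ n := by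
  set m := RingHom.ker (Bialgebra.counitAlgHom k A) with hm
  have hmem : ∀ a : A, a ∈ m ↔ counit (R := k) a = 0 := fun a => Iff.rfl
  have hsub : ∀ a : A, a - algebraMap k A (counit (R := k) a) ∈ m := by
    intro a; rw [hmem]; simp
  have : m.IsPrime := RingHom.ker_isPrime _
  have : IsNoetherianRing A := Algebra.FiniteType.isNoetherianRing k A
  obtain ⟨s, hs⟩ := (isNoetherianRing_iff_ideal_fg A).mp this m
  let U : Submodule k A := (m ^ 2).restrictScalars k ⊔ Submodule.span k {1}
  have hU1 : ∀ c : k, algebraMap k A c ∈ U := fun c => by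
    rw [Algebra.algebraMap_eq_smul_one]
    exact U.smul_mem _ (Submodule.mem_sup_right (Submodule.mem_span_singleton_self _))
  have hU2 : ∀ a ∈ m ^ 2, a ∈ U := fun a ha => Submodule.mem_sup_left ha
  have hUm : ∀ a ∈ U, a ∈ m → a ∈ m ^ 2 := by
    intro a ha ham
    obtain ⟨b, hb, c, hc, rfl⟩ := Submodule.mem_sup.mp ha
    obtain ⟨t, rfl⟩ := Submodule.mem_span_singleton.mp hc
    have hb' : b ∈ m ^ 2 := hb
    have h1 : t • (1 : A) ∈ m := by
      have := sub_mem ham (Ideal.pow_le_self two_ne_zero hb')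
      simpa using this
    rw [hmem] at h1
    have : t = 0 := by simpa using h1
    subst this
    simpa using hb'
  have hfin : Module.Finite k (A ⧸ U) := by
    classical
    refine ⟨⟨s.image U.mkQ, ?_⟩⟩
    set W := Submodule.span k (↑(s.image U.mkQ) : Set (A ⧸ U)) with hW
    have hz0 : ∀ u ∈ U, U.mkQ u = 0 := by
      intro u hu
      rwa [Submodule.mkQ_apply, Submodule.Quotient.mk_eq_zero]
    have key : ∀ z ∈ Ideal.span (s : Set A), U.mkQ z ∈ W := by
      intro z hz
      induction hz using Submodule.span_induction with
      | mem x hx => exact Submodule.subset_span (Finset.mem_coe.mpr (Finset.mem_image_of_mem _ hx))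
      | zero => rw [map_zero]; exact W.zero_mem
      | add x y _ _ h1 h2 => rw [map_add]; exact W.add_mem h1 h2
      | smul a x hx h =>
        have hxm : x ∈ m := by rw [← hs]; exact hx
        have e : a • x = counit (R := k) a • x + (a - algebraMap k A (counit (R := k) a)) * x := by
          rw [smul_eq_mul, Algebra.smul_def]; ring
        have h2 : (a - algebraMap k A (counit (R := k) a)) * x ∈ m ^ 2 := by
          rw [pow_two]; exact Ideal.mul_mem_mul (hsub a) hxm
        rw [e, map_add, map_smul, hz0 _ (hU2 _ h2), add_zero]
        exact W.smul_mem _ h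
    rw [eq_top_iff]
    intro q _
    obtain ⟨a, rfl⟩ := U.mkQ_surjective q
    have h1 := key (a - algebraMap k A (counit (R := k) a)) (by rw [hs]; exact hsub a)
    rwa [map_sub, hz0 _ (hU1 _), sub_zero] at h1
  let b := Module.finBasis k (A ⧸ U)
  choose x' hx' using fun i => U.mkQ_surjective (b i)
  let x := fun i => x' i - algebraMap k A (counit (R := k) (x' i))
  have hxm : ∀ i, x i ∈ m := fun i => hsub _
  have hxb : ∀ i, U.mkQ (x i) = b i := by
    intro i
    have : U.mkQ (algebraMap k A (counit (R := k) (x' i))) = 0 := by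
      rw [Submodule.mkQ_apply, Submodule.Quotient.mk_eq_zero]; exact hU1 _
    simp only [x, map_sub, this, sub_zero, hx']
  let d := fun i => b.coord i ∘ₗ U.mkQ
  have hd : ∀ i, ∀ a c, d i (a * c) = counit (R := k) a * d i c + counit (R := k) c * d i a := by
    intro i a c
    have h0 : ∀ u ∈ U, d i u = 0 := by
      intro u hu
      have : U.mkQ u = 0 := by rwa [Submodule.mkQ_apply, Submodule.Quotient.mk_eq_zero]
      simp only [d, LinearMap.comp_apply, this, map_zero]
    have h1 := h0 _ (hU2 _ (by rw [pow_two]; exact Ideal.mul_mem_mul (hsub a) (hsub c)))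
    have h2 := h0 _ (hU1 (counit (R := k) a * counit (R := k) c))
    have e : (a - algebraMap k A (counit (R := k) a)) * (c - algebraMap k A (counit (R := k) c))
      = a * c - counit (R := k) a • c - counit (R := k) c • a
        + algebraMap k A (counit (R := k) a * counit (R := k) c) := by
      simp only [Algebra.smul_def, map_mul]; ring
    rw [e, map_add, h2, map_sub, map_sub, map_smul, map_smul] at h1
    simp only [smul_eq_mul] at h1
    linear_combination h1
  refine cartier_euler m x hxm (fun i => cartierD (d i) (hd i)) ?_ n y hy
  intro z hz
  have h1 : (∑ i, d i z • x i) - z ∈ m ^ 2 := by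
    apply hUm
    · rw [← Submodule.Quotient.mk_eq_zero, ← Submodule.mkQ_apply, map_sub, map_sum, sub_eq_zero]
      simp only [map_smul, hxb]
      exact b.sum_repr _
    · exact sub_mem (sum_mem fun i _ => by
        rw [Algebra.smul_def]; exact Ideal.mul_mem_left _ _ (hxm i)) hz
  have h2 : ∑ i, (x i * cartierD (d i) (hd i) z - d i z • x i) ∈ m ^ 2 := by
    refine sum_mem fun i _ => ?_
    have e : x i * cartierD (d i) (hd i) z - d i z • x i
      = x i * (cartierD (d i) (hd i) z - algebraMap k A (d i z)) := by
      rw [Algebra.smul_def]; ring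
    rw [e, pow_two, ← counit_cartierD (d i) (hd i) z]
    exact Ideal.mul_mem_mul (hxm i) (hsub _)
  have := add_mem h2 h1
  rw [Finset.sum_sub_distrib] at this
  simpa using this

open WithConv in
theorem cartier_at_point [CharZero k] (hft : Algebra.FiniteType k A) (p : A →ₐ[k] k)
    (n : ℕ) (y : A) (hy : IsNilpotent y) : y ∈ RingHom.ker p ^ n := by
  let P : WithConv (A →ₐ[k] A) := toConv ((Algebra.ofId k A).comp p)
  let I : WithConv (A →ₐ[k] A) := toConv (AlgHom.id k A)
  let τ := (P * I).ofConv
  let σ := (P⁻¹ * I).ofConv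
  have hP : ∀ f : A →ₐ[k] A, toConv (f.comp P.ofConv) = P := by
    intro f
    apply WithConv.ofConv_injective
    ext a
    simp [P, Algebra.ofId_apply]
  have h1 : σ.comp τ = AlgHom.id k A := by
    have e := AlgHom.comp_convMul_distrib σ P I
    have e2 : toConv (σ.comp I.ofConv) = P⁻¹ * I := rfl
    rw [hP, e2, mul_inv_cancel_left] at e
    exact e
  have h2 : ∀ a ∈ RingHom.ker (Bialgebra.counitAlgHom k A), σ a ∈ RingHom.ker p := by
    have e := AlgHom.comp_convMul_distrib P.ofConv P⁻¹ I
    have e1 : toConv (P.ofConv.comp P⁻¹.ofConv) = P⁻¹ := by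
      apply WithConv.ofConv_injective
      ext a
      change algebraMap k A (p (algebraMap k A (p (HopfAlgebra.antipodeAlgHom k A a)))) =
        algebraMap k A (p (HopfAlgebra.antipodeAlgHom k A a))
      rw [AlgHom.commutes]; rfl
    have e2 : toConv (P.ofConv.comp I.ofConv) = P := rfl
    rw [e1, e2, inv_mul_cancel] at e
    intro a ha
    have h := congrArg (fun f : A →ₐ[k] A => f a) e
    have ha' : counit (R := k) a = 0 := ha
    have h' : algebraMap k A (p (σ a)) = algebraMap k A (counit (R := k) a) := h
    rw [ha', map_zero] at h'
    have h'' := congrArg p h'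
    rw [AlgHom.commutes, map_zero] at h''
    exact h''
  have h3 := cartier_at_one hft n (τ y) (hy.map τ)
  have h4 : σ (τ y) = y := congrArg (fun f : A →ₐ[k] A => f y) h1
  rw [← h4]
  have h5 := Ideal.mem_map_of_mem σ h3
  rw [Ideal.map_pow] at h5
  exact Ideal.pow_right_mono (Ideal.map_le_iff_le_comap.mpr h2) n h5

theorem cartier_algClosed [CharZero k] [IsAlgClosed k] (hft : Algebra.FiniteType k A) :
    IsReduced A := by
  refine ⟨fun y hy => ?_⟩
  have : IsNoetherianRing A := Algebra.FiniteType.isNoetherianRing k A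
  by_contra hne
  have hann : Ideal.span {y} ≠ ⊥ := by simpa using hne
  have hne' : (Submodule.annihilator (Ideal.span {y})) ≠ ⊤ := by
    intro h
    rw [Submodule.annihilator_eq_top_iff] at h
    exact hann h
  obtain ⟨M, hM, hle⟩ := Ideal.exists_le_maximal _ hne'
  let := Ideal.Quotient.field M
  have : Module.Finite k (A ⧸ M) := finite_of_finite_type_of_isJacobsonRing k (A ⧸ M)
  have hbij : Function.Bijective (algebraMap k (A ⧸ M)) :=
    IsAlgClosed.algebraMap_bijective_of_isIntegral
  let e : k ≃ₐ[k] (A ⧸ M) := AlgEquiv.ofBijective (Algebra.ofId k _) hbij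
  let p : A →ₐ[k] k := e.symm.toAlgHom.comp (Ideal.Quotient.mkₐ k M)
  have hp : RingHom.ker p = M := by
    ext a
    rw [RingHom.mem_ker]
    simp [p, Ideal.Quotient.eq_zero_iff_mem]
  have h := fun n => cartier_at_point hft p n y hy
  rw [hp] at h
  obtain ⟨r, hr⟩ := (M.mem_iInf_smul_pow_eq_bot_iff y).mp (by
    rw [Submodule.mem_iInf]; intro i; simpa using h i)
  have h1 : 1 - (r : A) ∈ Submodule.annihilator (Ideal.span {y}) := by
    rw [Ideal.span, Submodule.mem_annihilator_span_singleton, sub_smul, one_smul]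
    rw [sub_eq_zero]; exact hr.symm
  exact hM.ne_top ((Ideal.eq_top_iff_one _).mpr (by simpa using add_mem (hle h1) r.2))

end

/-- Cartier's theorem: every affine group scheme of finite type over a field of
characteristic zero is reduced. In Hopf-algebraic terms: a finitely generated commutative
Hopf algebra over a field of characteristic zero has no nonzero nilpotent elements. -/
theorem stmt_5 (k A : Type) [Field k] [CharZero k] [CommRing A] [HopfAlgebra k A]
    (hft : Algebra.FiniteType k A) : IsReduced A := by
  let K := AlgebraicClosure k
  have : CharZero K := charZero_of_injective_algebraMap (algebraMap k K).injective
  have : IsReduced (K ⊗[k] A) := cartier_algClosed (k := K) inferInstance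
  exact isReduced_of_injective (Algebra.TensorProduct.includeRight : A →ₐ[k] K ⊗[k] A)
    (Algebra.TensorProduct.includeRight_injective (algebraMap k K).injective)
end

section
/- Let k be a field of characteristic zero and let G = Spec A be an affine group scheme over k (A a commutative Hopf k-algebra, not necessarily finitely generated). If the group G(K) of K-valued points is trivial for every field extension K of k, then G is the trivial group scheme, i.e., the unit morphism Spec k → G is an isomorphism. -/
open TensorProduct

/-- Local finiteness of the regular comodule. -/
lemma aux_locfin {k A : Type} [Field k] [CommRing A] [HopfAlgebra k A] (x : A) :
    ∃ V : Submodule k A, V.FG ∧ x ∈ V ∧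
      ∀ v ∈ V, Coalgebra.comul (R := k) v ∈ LinearMap.range (V.subtype.lTensor A) := by
  let c : (A →ₗ[k] k) → A ⊗[k] A →ₗ[k] A := fun f =>
    (TensorProduct.lid k A).toLinearMap ∘ₗ f.rTensor A
  have hc : ∀ f a b, c f (a ⊗ₜ b) = f a • b := by
    intro f a b; simp [c]
  let V : Submodule k A := Submodule.span k (Set.range fun f => c f (Coalgebra.comul (R := k) x))
  have hexp : ∀ t : A ⊗[k] A, ∀ W : Submodule k A, (∀ f, c f t ∈ W) →
      t ∈ LinearMap.range (W.subtype.lTensor A) := by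
    intro t W hW
    let b := Module.Basis.ofVectorSpace k A
    obtain ⟨s, hs⟩ : ∃ s : Finset _, ∀ s' , s ⊆ s' → t = ∑ i ∈ s', b i ⊗ₜ[k] c (b.coord i) t := by
      classical
      clear hW
      induction t using TensorProduct.induction_on with
      | zero => exact ⟨∅, by simp⟩
      | tmul a y =>
        refine ⟨(b.repr a).support, fun s' hs' => ?_⟩
        simp only [hc]
        conv_lhs => rw [← b.linearCombination_repr a, Finsupp.linearCombination_apply,
          Finsupp.sum_of_support_subset _ hs' _ (by simp), TensorProduct.sum_tmul]
        simp [TensorProduct.smul_tmul]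
      | add t u ht hu =>
        obtain ⟨s, hs⟩ := ht
        obtain ⟨r, hr⟩ := hu
        refine ⟨s ∪ r, fun s' hs' => ?_⟩
        simp only [map_add, TensorProduct.tmul_add, Finset.sum_add_distrib]
        rw [← hs s' (Finset.union_subset_left hs'), ← hr s' (Finset.union_subset_right hs')]
    rw [hs s le_rfl]
    exact Submodule.sum_mem _ fun i _ => ⟨b i ⊗ₜ ⟨c (b.coord i) t, hW _⟩, by simp⟩
  refine ⟨V, ?_, ?_, ?_⟩
  · obtain ⟨s, hs⟩ := TensorProduct.exists_finset (R := k) (Coalgebra.comul (R := k) x)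
    classical
    have hle : V ≤ Submodule.span k ((s.image Prod.snd : Finset A) : Set A) := by
      refine Submodule.span_le.2 ?_
      rintro _ ⟨f, rfl⟩
      simp only [hs, map_sum, hc]
      exact Submodule.sum_mem _ fun i hi => Submodule.smul_mem _ _
        (Submodule.subset_span (Finset.mem_coe.2 (Finset.mem_image_of_mem _ hi)))
    have : FiniteDimensional k (Submodule.span k ((s.image Prod.snd : Finset A) : Set A)) :=
      FiniteDimensional.span_finset k _
    have := Submodule.finiteDimensional_of_le hle
    exact (Submodule.fg_iff_finiteDimensional V).2 this
  · refine Submodule.subset_span ⟨Coalgebra.counit, ?_⟩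
    simp [c]
  · have hx : Coalgebra.comul (R := k) x ∈ LinearMap.range (V.subtype.lTensor A) :=
      hexp _ _ fun f => Submodule.subset_span ⟨f, rfl⟩
    have key : ∀ f t, Coalgebra.comul (R := k) (c f t) =
        (TensorProduct.lid k (A ⊗[k] A)).toLinearMap (f.rTensor (A ⊗[k] A)
          ((Coalgebra.comul (R := k)).lTensor A t)) := by
      intro f t
      induction t using TensorProduct.induction_on with
      | zero => simp
      | tmul a y => simp [hc]
      | add t u ht hu => simp only [map_add, ht, hu]
    intro v hv
    suffices hVle : V ≤ (LinearMap.range (V.subtype.lTensor A)).comap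
      (Coalgebra.comul (R := k)) from hVle hv
    refine Submodule.span_le.2 ?_
    rintro _ ⟨f, rfl⟩
    simp only [Submodule.comap_coe, Set.mem_preimage, SetLike.mem_coe]
    rw [key, ← Coalgebra.coassoc_apply]
    obtain ⟨t, ht⟩ := hx
    rw [← ht]
    clear ht
    induction t using TensorProduct.induction_on with
    | zero => simp
    | add t u ht hu => simp only [map_add]; exact Submodule.add_mem _ ht hu
    | tmul a y =>
      simp only [LinearMap.lTensor_tmul, LinearMap.rTensor_tmul, Submodule.subtype_apply]
      generalize Coalgebra.comul (R := k) a = w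
      induction w using TensorProduct.induction_on with
      | zero => simp
      | add t u ht hu =>
        simp only [map_add, TensorProduct.add_tmul]; exact Submodule.add_mem _ ht hu
      | tmul p q => exact ⟨(f p • q) ⊗ₜ y, by simp [TensorProduct.smul_tmul']⟩

/-- Points with trivial values force the augmentation ideal to be nil. -/
lemma aux_nil {k A : Type} [Field k] [CommRing A] [HopfAlgebra k A]
    (h : ∀ (K : Type) [Field K] [Algebra k K], Subsingleton (A →ₐ[k] K)) (x : A)
    (hx : Coalgebra.counit (R := k) x = 0) : IsNilpotent x := by
  rw [← mem_nilradical, nilradical_eq_sInf, Ideal.mem_sInf]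
  intro P hP
  have hP : P.IsPrime := hP
  have := (h P.ResidueField).elim (IsScalarTower.toAlgHom k A P.ResidueField)
    ((Algebra.ofId k _).comp (Bialgebra.counitAlgHom k A))
  have := DFunLike.congr_fun this x
  simp [hx] at this
  exact this

/-- Existence of point derivations. -/
lemma aux_der {k B : Type} [Field k] [CommRing B] [Algebra k B] (e : B →ₐ[k] k) (m : Ideal B)
    (hm : ∀ y : B, y ∈ m ↔ e y = 0) (y : B) (hym : y ∈ m) (hy2 : y ∉ m • m) :
    ∃ d : B →ₗ[k] k, d y ≠ 0 ∧ (∀ a b, d (a * b) = e a * d b + d a * e b) := by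
  obtain ⟨φ, hφy, hφ⟩ := Submodule.exists_le_ker_of_notMem
    (p := (m • m : Ideal B).restrictScalars k) (v := y) hy2
  let d : B →ₗ[k] k := φ ∘ₗ (LinearMap.id - (Algebra.linearMap k B) ∘ₗ e.toLinearMap)
  have hdd : ∀ a, d a = φ (a - algebraMap k B (e a)) := fun a => rfl
  have hd : ∀ a b, d (a * b) = e a * d b + d a * e b := by
    intro a b
    have h1 : ∀ a, a - algebraMap k B (e a) ∈ m := fun a => by simp [hm]
    have h2 : φ ((a - algebraMap k B (e a)) * (b - algebraMap k B (e b))) = 0 :=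
      LinearMap.mem_ker.1 (hφ (show _ ∈ m • m from Submodule.smul_mem_smul (h1 a) (h1 b)))
    have h3 : a * b - algebraMap k B (e (a * b)) =
        (a - algebraMap k B (e a)) * (b - algebraMap k B (e b))
        + e a • (b - algebraMap k B (e b)) + e b • (a - algebraMap k B (e a)) := by
      simp only [map_mul, Algebra.smul_def]; ring
    rw [hdd, h3, map_add, map_add, h2, map_smul, map_smul, ← hdd, ← hdd]
    simp only [smul_eq_mul]; ring
  have hey : e y = 0 := (hm y).1 hym
  refine ⟨d, ?_, hd⟩
  rw [hdd, hey]; simpa using hφy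

lemma aux_main {k A : Type} [Field k] [CharZero k] [CommRing A] [HopfAlgebra k A]
    (hnil : ∀ x : A, Coalgebra.counit (R := k) x = 0 → IsNilpotent x)
    (B : Subalgebra k A) (hB : B.FG)
    (hΔ : ∀ v ∈ B, Coalgebra.comul (R := k) v ∈
      (Algebra.TensorProduct.map (AlgHom.id k A) B.val).range) (x : A) (hxB : x ∈ B)
    (hx : Coalgebra.counit (R := k) x = 0) : x = 0 := by
  let e : B →ₐ[k] k := (Bialgebra.counitAlgHom k A).comp B.val
  have he : ∀ y : B, e y = Coalgebra.counit (R := k) (y : A) := fun y => rfl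
  let m : Ideal B := RingHom.ker e
  have hm : ∀ y : B, y ∈ m ↔ e y = 0 := fun y => RingHom.mem_ker
  have hFT : Algebra.FiniteType k B := B.fg_iff_finiteType.1 hB
  have hN : IsNoetherianRing B := Algebra.FiniteType.isNoetherianRing k B
  by_contra hx0
  have hmm : ¬ m ≤ m • m := by
    intro hle
    have hj : m ≤ Ideal.jacobson ⊥ := by
      intro y hy
      obtain ⟨n, hn⟩ := hnil y ((hm y).1 hy)
      have hyn : IsNilpotent y := ⟨n, Subtype.ext (by simpa using hn)⟩
      exact Ideal.radical_le_jacobson (show y ∈ nilradical B from hyn)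
    have h0 := Submodule.eq_bot_of_le_smul_of_le_jacobson_bot m m (IsNoetherian.noetherian m) hle hj
    have : (⟨x, hxB⟩ : B) ∈ m := (hm _).2 hx
    rw [h0] at this
    exact hx0 (congrArg Subtype.val ((Submodule.mem_bot B).1 this))
  obtain ⟨y, hym, hy2⟩ := SetLike.not_le_iff_exists.1 hmm
  obtain ⟨d, hdy, hd⟩ := aux_der e m hm y hym hy2
  let π : A ⊗[k] B →ₗ[k] A := (TensorProduct.rid k A).toLinearMap ∘ₗ e.toLinearMap.lTensor A
  let θ : A ⊗[k] B →ₗ[k] A := (TensorProduct.rid k A).toLinearMap ∘ₗ d.lTensor A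
  have hθ : ∀ s t, θ (s * t) = π s * θ t + θ s * π t := by
    intro s t
    induction s using TensorProduct.induction_on with
    | zero => simp
    | add s u hs hu => simp only [add_mul, map_add, hs, hu]; ring
    | tmul a b =>
      induction t using TensorProduct.induction_on with
      | zero => simp
      | add s u hs hu => simp only [mul_add, map_add, hs, hu]; ring
      | tmul p q =>
        simp [θ, π, hd, Algebra.smul_def]; ring
  let j := Algebra.TensorProduct.map (AlgHom.id k A) B.val
  obtain ⟨t, ht⟩ : ∃ t, j t = Coalgebra.comul (R := k) (y : A) := hΔ y y.2
  have hπ : π t = y := by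
    have h1 : ∀ t, π t = TensorProduct.rid k A ((Coalgebra.counit (R := k)).lTensor A (j t)) := by
      intro t
      induction t using TensorProduct.induction_on with
      | zero => simp
      | add s u hs hu => simp only [map_add, hs, hu]
      | tmul p q => simp [π, j, he]
    rw [h1, ht]; simp
  have hεθ : Coalgebra.counit (R := k) (θ t) = d y := by
    obtain ⟨d', hd'⟩ := LinearMap.exists_extend (p := Subalgebra.toSubmodule B) d
    have hd'' : ∀ b : B, d' b = d b := fun b => DFunLike.congr_fun hd' b
    have h1 : ∀ t, Coalgebra.counit (R := k) (θ t) =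
        d' (TensorProduct.lid k A ((Coalgebra.counit (R := k)).rTensor A (j t))) := by
      intro t
      induction t using TensorProduct.induction_on with
      | zero => simp
      | add s u hs hu => simp only [map_add, hs, hu]
      | tmul p q => simp [θ, j, hd'', mul_comm]
    rw [h1, ht]; simp [hd'']
  have hey : e y = 0 := (hm y).1 hym
  have hunit : IsUnit (θ t) := by
    have h1 : IsNilpotent (θ t - algebraMap k A (d y)) := hnil _ (by simp [hεθ])
    have h2 : IsUnit (algebraMap k A (d y)) := (IsUnit.mk0 _ hdy).map _
    have := h1.isUnit_add_right_of_commute h2 (Commute.all _ _)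
    simpa using this
  have hpow : ∀ n : ℕ, π (t ^ n) = (y : A) ^ n ∧
      θ (t ^ (n + 1)) = ((n + 1 : ℕ) : A) * (y : A) ^ n * θ t := by
    have hπm : ∀ s t, π (s * t) = π s * π t := by
      intro s t
      induction s using TensorProduct.induction_on with
      | zero => simp
      | add s u hs hu => simp only [add_mul, map_add, hs, hu]
      | tmul a b =>
        induction t using TensorProduct.induction_on with
        | zero => simp
        | add s u hs hu => simp only [mul_add, map_add, hs, hu]
        | tmul p q => simp [π, Algebra.smul_def]; ring
    have h1 : ∀ n : ℕ, π (t ^ n) = (y : A) ^ n := by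
      intro n
      induction n with
      | zero => simp [π, Algebra.TensorProduct.one_def]
      | succ n ih => rw [pow_succ, hπm, ih, hπ, pow_succ]
    intro n
    refine ⟨h1 n, ?_⟩
    induction n with
    | zero => simp
    | succ n ih => rw [pow_succ, hθ, ih, h1, hπ]; push_cast; ring
  have hinj : Function.Injective j := by
    have : Function.Injective (B.val.toLinearMap.lTensor A) :=
      Module.Flat.lTensor_preserves_injective_linearMap _ Subtype.val_injective
    exact this
  have hdesc : ∀ n : ℕ, (y : A) ^ n = 0 → (1 : A) = 0 := by
    intro n
    induction n with
    | zero => simp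
    | succ n ih =>
      intro hn
      apply ih
      have h1 : t ^ (n + 1) = 0 := by
        apply hinj
        rw [map_pow, ht, map_zero]
        have := congrArg (Bialgebra.comulAlgHom k A) hn
        simpa using this
      have h2 := (hpow n).2
      rw [h1, map_zero] at h2
      have h3 : IsUnit (((n + 1 : ℕ) : A)) := by
        have : IsUnit ((n + 1 : ℕ) : k) := IsUnit.mk0 _ (Nat.cast_ne_zero.2 n.succ_ne_zero)
        simpa using this.map (algebraMap k A)
      have h4 := hunit.mul_left_eq_zero.1 h2.symm
      exact h3.mul_right_eq_zero.1 h4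
  obtain ⟨n, hn⟩ := hnil y hey
  have h10 := hdesc n hn
  apply hx0
  rw [← one_mul x, h10, zero_mul]


/-- Let `G = Spec A` be an affine group scheme over a field `k` of characteristic zero
(`A` a commutative Hopf `k`-algebra, not necessarily finitely generated). If the group of
`K`-valued points `G(K) = Hom_{k-alg}(A, K)` is trivial for every field extension `K` of
`k`, then `G` is the trivial group scheme, i.e. the unit `Spec k → G` is an isomorphism,
i.e. the structure map `k → A` is bijective. -/
theorem stmt_6 (k A : Type) [Field k] [CharZero k] [CommRing A] [HopfAlgebra k A]
    (h : ∀ (K : Type) [Field K] [Algebra k K], Subsingleton (A →ₐ[k] K)) :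
    Function.Bijective (algebraMap k A) := by
  have hnil := aux_nil h
  refine ⟨fun a b hab => ?_, fun x => ?_⟩
  · simpa using congrArg (Coalgebra.counit (R := k) (A := A)) hab
  · obtain ⟨V, hV, hxV, hΔ⟩ := aux_locfin (k := k) x
    obtain ⟨s, hs⟩ := hV
    let B := Algebra.adjoin k (s : Set A)
    have hVB : V ≤ Subalgebra.toSubmodule B := by
      rw [← hs]; exact Algebra.span_le_adjoin k _
    refine ⟨Coalgebra.counit (R := k) x, ?_⟩
    have hle : B ≤ ((Algebra.TensorProduct.map (AlgHom.id k A) B.val).range).comap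
        (Bialgebra.comulAlgHom k A) := by
      refine Algebra.adjoin_le fun v hv => ?_
      obtain ⟨t, ht⟩ := hΔ v (hs ▸ Submodule.subset_span hv)
      show Coalgebra.comul (R := k) v ∈ (Algebra.TensorProduct.map (AlgHom.id k A) B.val).range
      rw [← ht]
      clear ht
      induction t using TensorProduct.induction_on with
      | zero => simp
      | add s u hs hu => rw [map_add]; exact add_mem hs hu
      | tmul p q => exact ⟨p ⊗ₜ ⟨q, hVB q.2⟩, by simp⟩
    have := aux_main hnil B ⟨s, rfl⟩ (fun v hv => hle hv)
      (x - algebraMap k A (Coalgebra.counit (R := k) x))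
      (sub_mem (hVB hxV) (B.algebraMap_mem _)) (by simp)
    exact (sub_eq_zero.1 this).symm
end

section
/- Let K be a field of characteristic zero. Every commutative unipotent algebraic group over K is isomorphic to a finite product G_a^n of copies of the additive group. More generally, every commutative pro-unipotent affine group scheme over K is, as a group-valued functor on commutative K-algebras, of the form R ↦ Hom_K(V, R) for some K-vector space V (i.e., isomorphic to Spec of a polynomial Hopf algebra K[I] with primitive generators). -/
open scoped TensorProduct

/-- A (co)representation of the affine group scheme `Spec A` associated to a commutative
Hopf algebra `A` over `k`, on a `k`-module `V`: a counital coassociative coaction. -/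
structure HopfCoaction (k A V : Type) [CommRing k] [CommRing A] [HopfAlgebra k A]
    [AddCommGroup V] [Module k V] where
  ρ : V →ₗ[k] V ⊗[k] A
  counit_comp :
    (TensorProduct.rid k V).toLinearMap ∘ₗ
        LinearMap.lTensor V (Coalgebra.counit : A →ₗ[k] k) ∘ₗ ρ = LinearMap.id
  coassoc :
    (TensorProduct.assoc k V A A).toLinearMap ∘ₗ LinearMap.rTensor A ρ ∘ₗ ρ =
      LinearMap.lTensor V (Coalgebra.comul : A →ₗ[k] A ⊗[k] A) ∘ₗ ρ

/-- `Spec A` is unipotent: every nonzero finite-dimensional representation has a nonzero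
fixed vector. -/
def IsUnipotentHopf (k A : Type) [Field k] [CommRing A] [HopfAlgebra k A] : Prop :=
  ∀ (V : Type) [AddCommGroup V] [Module k V] [FiniteDimensional k V] [Nontrivial V]
    (c : HopfCoaction k A V), ∃ v : V, v ≠ 0 ∧ c.ρ v = v ⊗ₜ[k] (1 : A)

/-- The convolution product of two points `φ, ψ : Spec R → Spec A` of the affine group
scheme `Spec A`, i.e. the group law on `A →ₐ[K] R`: multiply in `R` after applying
`φ ⊗ ψ` to the comultiplication of `A`. -/
noncomputable def convMul (K A R : Type) [CommRing K] [CommRing A] [HopfAlgebra K A]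
    [CommRing R] [Algebra K R] (φ ψ : A →ₐ[K] R) : A →ₐ[K] R :=
  ((Algebra.TensorProduct.lmul' K).comp (Algebra.TensorProduct.map φ ψ)).comp
    (Bialgebra.comulAlgHom K A)

/-- A presentation of the group-valued points functor `R ↦ G(R) = (A →ₐ[K] R)` of
`G = Spec A` as the functor `R ↦ Hom_K(V, R)` for a `K`-vector space `V`: a family of
bijections, natural in `R`, converting the convolution group law into addition. -/
structure AdditivePointsModel (K A : Type) [Field K] [CommRing A] [HopfAlgebra K A] where
  V : Type
  [addCommGroup : AddCommGroup V]
  [module : Module K V]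
  e : ∀ (R : Type) [CommRing R] [Algebra K R], (A →ₐ[K] R) ≃ (V →ₗ[K] R)
  additive : ∀ (R : Type) [CommRing R] [Algebra K R] (φ ψ : A →ₐ[K] R),
    e R (convMul K A R φ ψ) = e R φ + e R ψ
  natural : ∀ (R R' : Type) [CommRing R] [Algebra K R] [CommRing R'] [Algebra K R']
    (g : R →ₐ[K] R') (φ : A →ₐ[K] R), e R' (g.comp φ) = g.toLinearMap ∘ₗ e R φ

/-- A presentation of the points functor of `Spec A` as `G_a^m`: natural additive
bijections `(A →ₐ[K] R) ≃ Hom_K(K^m, R) (≅ R^m)`. -/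
structure GaPowerModel (K A : Type) [Field K] [CommRing A] [HopfAlgebra K A] where
  m : ℕ
  e : ∀ (R : Type) [CommRing R] [Algebra K R], (A →ₐ[K] R) ≃ ((Fin m → K) →ₗ[K] R)
  additive : ∀ (R : Type) [CommRing R] [Algebra K R] (φ ψ : A →ₐ[K] R),
    e R (convMul K A R φ ψ) = e R φ + e R ψ
  natural : ∀ (R R' : Type) [CommRing R] [Algebra K R] [CommRing R'] [Algebra K R']
    (g : R →ₐ[K] R') (φ : A →ₐ[K] R), e R' (g.comp φ) = g.toLinearMap ∘ₗ e R φ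

section CoactionTools

open TensorProduct

variable {K A V : Type} [Field K] [CommRing A] [HopfAlgebra K A] [AddCommGroup V] [Module K V]

theorem mkQ_rTensor_mono {U U' : Submodule K V} (h : U ≤ U') {x : V ⊗[K] A}
    (hx : LinearMap.rTensor A U.mkQ x = 0) : LinearMap.rTensor A U'.mkQ x = 0 := by
  have : U'.mkQ = (Submodule.factor h) ∘ₗ U.mkQ := by ext; simp
  rw [this, LinearMap.rTensor_comp, LinearMap.comp_apply, hx, map_zero]

theorem mkQ_rTensor_eq_zero_iff (U : Submodule K V) (x : V ⊗[K] A) :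
    LinearMap.rTensor A U.mkQ x = 0 ↔ ∃ y, LinearMap.rTensor A U.subtype y = x :=
  (rTensor_exact A (LinearMap.exact_subtype_mkQ U) (Submodule.mkQ_surjective U)) x

theorem lTensor_rTensor_swap {V W X Y : Type} [AddCommGroup V] [Module K V] [AddCommGroup W]
    [Module K W] [AddCommGroup X] [Module K X] [AddCommGroup Y] [Module K Y]
    (f : V →ₗ[K] W) (g : X →ₗ[K] Y) (x : V ⊗[K] X) :
    LinearMap.lTensor W g (LinearMap.rTensor X f x) =
      LinearMap.rTensor Y f (LinearMap.lTensor V g x) := by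
  rw [← LinearMap.comp_apply, ← LinearMap.comp_apply, LinearMap.lTensor_comp_rTensor,
    LinearMap.rTensor_comp_lTensor]

/-- The quotient of a coaction by a stable subspace. -/
theorem HopfCoaction.exists_quot (c : HopfCoaction K A V) (U : Submodule K V)
    (hU : ∀ u ∈ U, LinearMap.rTensor A U.mkQ (c.ρ u) = 0) :
    ∃ d : HopfCoaction K A (V ⧸ U), ∀ v, d.ρ (U.mkQ v) = LinearMap.rTensor A U.mkQ (c.ρ v) := by
  obtain ⟨r, hr⟩ : ∃ r : V ⧸ U →ₗ[K] (V ⧸ U) ⊗[K] A,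
      ∀ v, r (U.mkQ v) = LinearMap.rTensor A U.mkQ (c.ρ v) :=
    ⟨U.liftQ (LinearMap.rTensor A U.mkQ ∘ₗ c.ρ) (fun u hu => hU u hu), fun v => rfl⟩
  refine ⟨⟨r, ?_, ?_⟩, hr⟩
  · apply Submodule.linearMap_qext
    ext v
    have h := LinearMap.congr_fun c.counit_comp v
    simp only [LinearMap.comp_apply, hr, LinearMap.id_apply, LinearEquiv.coe_coe] at h ⊢
    rw [lTensor_rTensor_swap]
    conv_rhs => rw [← h]
    generalize LinearMap.lTensor V Coalgebra.counit (c.ρ v) = x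
    induction x with
    | zero => simp
    | tmul a b => simp
    | add a b ha hb => simp only [map_add, ha, hb]
  · apply Submodule.linearMap_qext
    ext v
    have h := LinearMap.congr_fun c.coassoc v
    simp only [LinearMap.comp_apply, hr, LinearEquiv.coe_coe] at h ⊢
    rw [lTensor_rTensor_swap, ← h]
    generalize c.ρ v = x
    induction x with
    | zero => simp
    | tmul a b =>
      simp only [LinearMap.rTensor_tmul, hr]
      generalize c.ρ a = y
      induction y with
      | zero => simp
      | tmul a b => simp
      | add a b ha hb => simp only [map_add, ha, hb, add_tmul]
    | add a b ha hb => simp only [map_add, ha, hb]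

/-- The restriction of a coaction to a stable subspace. -/
theorem HopfCoaction.exists_sub (c : HopfCoaction K A V) (U : Submodule K V)
    (hU : ∀ u ∈ U, LinearMap.rTensor A U.mkQ (c.ρ u) = 0) :
    ∃ d : HopfCoaction K A U, ∀ u, LinearMap.rTensor A U.subtype (d.ρ u) = c.ρ u := by
  have hinj : Function.Injective (LinearMap.rTensor A U.subtype) :=
    Module.Flat.rTensor_preserves_injective_linearMap _ U.injective_subtype
  have hmem : ∀ u : U, (c.ρ ∘ₗ U.subtype) u ∈ LinearMap.range (LinearMap.rTensor A U.subtype) :=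
    fun u => (mkQ_rTensor_eq_zero_iff U _).1 (hU u u.2)
  obtain ⟨r, hr⟩ : ∃ r : U →ₗ[K] U ⊗[K] A, ∀ u, LinearMap.rTensor A U.subtype (r u) = c.ρ u := by
    let e := LinearEquiv.ofInjective _ hinj
    refine ⟨e.symm.toLinearMap ∘ₗ LinearMap.codRestrict _ (c.ρ ∘ₗ U.subtype) hmem, fun u => ?_⟩
    exact congrArg Subtype.val (e.apply_symm_apply ⟨(c.ρ ∘ₗ U.subtype) u, hmem u⟩)
  refine ⟨⟨r, ?_, ?_⟩, hr⟩
  · ext u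
    have h := LinearMap.congr_fun c.counit_comp u
    simp only [LinearMap.comp_apply, LinearMap.id_apply, LinearEquiv.coe_coe] at h ⊢
    conv_rhs => rw [← h]
    rw [← hr, lTensor_rTensor_swap]
    generalize LinearMap.lTensor U Coalgebra.counit (r u) = x
    induction x with
    | zero => simp
    | tmul a b => simp
    | add a b ha hb => simp only [map_add, ← ha, ← hb, Submodule.coe_add]
  · ext u
    have h := LinearMap.congr_fun c.coassoc u
    have hinj2 : Function.Injective (LinearMap.rTensor (A ⊗[K] A) U.subtype) :=
      Module.Flat.rTensor_preserves_injective_linearMap _ U.injective_subtype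
    apply hinj2
    simp only [LinearMap.comp_apply, LinearEquiv.coe_coe] at h ⊢
    rw [← lTensor_rTensor_swap, hr, ← h, ← hr]
    generalize r u = x
    induction x with
    | zero => simp
    | tmul a b =>
      simp only [LinearMap.rTensor_tmul, Submodule.subtype_apply, ← hr]
      generalize r a = y
      induction y with
      | zero => simp
      | tmul a b => simp
      | add a b ha hb => simp only [map_add, ha, hb, add_tmul]
    | add a b ha hb => simp only [map_add, ha, hb]

/-- Local finiteness of coactions. -/
theorem HopfCoaction.exists_finite (c : HopfCoaction K A V) (v : V) :
    ∃ U : Submodule K V, v ∈ U ∧ FiniteDimensional K U ∧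
      ∀ u ∈ U, LinearMap.rTensor A U.mkQ (c.ρ u) = 0 := by
  obtain ⟨W, hW, hv⟩ := TensorProduct.exists_finite_submodule_left_of_setFinite {c.ρ v}
    (Set.finite_singleton _)
  let g := LinearMap.rTensor A W.mkQ ∘ₗ c.ρ
  refine ⟨LinearMap.ker g, ?_, ?_, ?_⟩
  · simp only [g, LinearMap.mem_ker, LinearMap.comp_apply, mkQ_rTensor_eq_zero_iff]
    exact hv rfl
  · have : LinearMap.ker g ≤ W := by
      intro u hu
      obtain ⟨y, hy⟩ := (mkQ_rTensor_eq_zero_iff W _).1 (show LinearMap.rTensor A W.mkQ (c.ρ u) = 0 from hu)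
      have h := LinearMap.congr_fun c.counit_comp u
      simp only [LinearMap.comp_apply, LinearMap.id_apply, LinearEquiv.coe_coe] at h
      rw [← h, ← hy]
      clear hy h hu
      induction y with
      | zero => simp
      | tmul a b => simpa using W.smul_mem _ a.2
      | add a b ha hb => simp only [map_add]; exact W.add_mem ha hb
    exact Submodule.finiteDimensional_of_le this
  · intro u hu
    have hex : Function.Exact (LinearMap.rTensor A (LinearMap.ker g).subtype)
        (LinearMap.rTensor A g) :=
      Module.Flat.rTensor_exact A (LinearMap.exact_subtype_ker_map g)
    rw [mkQ_rTensor_eq_zero_iff]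
    refine (hex _).1 ?_
    have h := LinearMap.congr_fun c.coassoc u
    simp only [LinearMap.comp_apply, LinearEquiv.coe_coe] at h
    have hu' : LinearMap.rTensor A W.mkQ (c.ρ u) = 0 := hu
    simp only [g, LinearMap.rTensor_comp, LinearMap.comp_apply]
    have h2 : LinearMap.rTensor (A ⊗[K] A) W.mkQ
        (TensorProduct.assoc K V A A (LinearMap.rTensor A c.ρ (c.ρ u))) = 0 := by
      rw [h, ← lTensor_rTensor_swap, hu', map_zero]
    generalize LinearMap.rTensor A c.ρ (c.ρ u) = x at h2
    have h3 : LinearMap.rTensor (A ⊗[K] A) W.mkQ (TensorProduct.assoc K V A A x) =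
      TensorProduct.assoc K _ A A (LinearMap.rTensor A (LinearMap.rTensor A W.mkQ) x) := by
      have : LinearMap.rTensor (A ⊗[K] A) W.mkQ ∘ₗ (TensorProduct.assoc K V A A).toLinearMap =
        (TensorProduct.assoc K _ A A).toLinearMap ∘ₗ (LinearMap.rTensor A (LinearMap.rTensor A W.mkQ)) := by
        apply TensorProduct.ext_threefold
        intro a b c
        simp
      exact LinearMap.congr_fun this x
    rw [h3] at h2
    simpa using h2

theorem HopfCoaction.exists_fixed (hA : IsUnipotentHopf K A) [Nontrivial V]
    (c : HopfCoaction K A V) : ∃ v : V, v ≠ 0 ∧ c.ρ v = v ⊗ₜ[K] (1 : A) := by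
  obtain ⟨v, hv⟩ := exists_ne (0 : V)
  obtain ⟨U, hvU, hfin, hU⟩ := c.exists_finite v
  obtain ⟨d, hd⟩ := c.exists_sub U hU
  have : Nontrivial U := ⟨⟨⟨v, hvU⟩, 0, fun h => hv (congrArg Subtype.val h)⟩⟩
  obtain ⟨u, hu, hu'⟩ := hA U d
  refine ⟨u, fun h => hu (Subtype.ext h), ?_⟩
  rw [← hd, hu']
  simp

/-- The regular coaction. -/
noncomputable def regCoaction (K A : Type) [Field K] [CommRing A] [HopfAlgebra K A] :
    HopfCoaction K A A where
  ρ := Coalgebra.comul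
  counit_comp := by ext a; simp
  coassoc := by ext a; simp

/-- The map `a ↦ Δ a - a ⊗ 1`. -/
noncomputable def redComul (K A : Type) [Field K] [CommRing A] [HopfAlgebra K A] :
    A →ₗ[K] A ⊗[K] A :=
  Coalgebra.comul - (TensorProduct.mk K A A).flip 1

/-- The (one-sided) coradical filtration. -/
noncomputable def corFil (K A : Type) [Field K] [CommRing A] [HopfAlgebra K A] :
    ℕ → Submodule K A
  | 0 => ⊥
  | n + 1 => LinearMap.ker (LinearMap.rTensor A (corFil K A n).mkQ ∘ₗ redComul K A)

theorem mem_corFil_succ (n : ℕ) (a : A) : a ∈ corFil K A (n + 1) ↔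
    LinearMap.rTensor A (corFil K A n).mkQ (redComul K A a) = 0 := Iff.rfl

theorem corFil_mono : Monotone (corFil K A) := by
  apply monotone_nat_of_le_succ
  intro n
  induction n with
  | zero => exact bot_le
  | succ n ih =>
    intro a ha
    rw [mem_corFil_succ] at ha ⊢
    exact mkQ_rTensor_mono ih ha

theorem corFil_stable (n : ℕ) (a : A) (ha : a ∈ corFil K A n) :
    LinearMap.rTensor A (corFil K A n).mkQ (Coalgebra.comul (R := K) a) = 0 := by
  cases n with
  | zero =>
    have : a = 0 := ha
    simp [this]
  | succ n =>
    have h := mkQ_rTensor_mono (corFil_mono n.le_succ) ((mem_corFil_succ n a).1 ha)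
    have h2 : Coalgebra.comul (R := K) a = redComul K A a + a ⊗ₜ 1 := by simp [redComul]
    rw [h2, map_add, h, zero_add, LinearMap.rTensor_tmul, Submodule.mkQ_apply,
      (Submodule.Quotient.mk_eq_zero _).2 ha, zero_tmul]

theorem exists_mem_corFil (hA : IsUnipotentHopf K A) (a : A) : ∃ n, a ∈ corFil K A n := by
  have hmem : ∀ b, b ∈ (⨆ n, corFil K A n) ↔ ∃ n, b ∈ corFil K A n :=
    fun b => Submodule.mem_iSup_of_directed _ corFil_mono.directed_le
  rw [← hmem]
  by_contra hcon
  have hst : ∀ u ∈ (⨆ n, corFil K A n),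
      LinearMap.rTensor A (⨆ n, corFil K A n).mkQ ((regCoaction K A).ρ u) = 0 := by
    intro u hu
    obtain ⟨n, hn⟩ := (hmem u).1 hu
    exact mkQ_rTensor_mono (le_iSup _ n) (corFil_stable n u hn)
  have : Nontrivial (A ⧸ (⨆ n, corFil K A n)) := by
    refine ⟨⟨Submodule.Quotient.mk a, 0, fun h => hcon ?_⟩⟩
    exact (Submodule.Quotient.mk_eq_zero _).1 h
  obtain ⟨d, hd⟩ := (regCoaction K A).exists_quot _ hst
  obtain ⟨v, hv, hv'⟩ := HopfCoaction.exists_fixed hA d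
  obtain ⟨b, rfl⟩ := Submodule.mkQ_surjective _ v
  have h1 : LinearMap.rTensor A (⨆ n, corFil K A n).mkQ (redComul K A b) = 0 := by
    rw [hd] at hv'
    simp only [regCoaction] at hv'
    simp [redComul, hv']
  obtain ⟨y, hy⟩ := (mkQ_rTensor_eq_zero_iff _ _).1 h1
  have h2 : ∀ y : ↥(⨆ n, corFil K A n) ⊗[K] A, ∃ n, LinearMap.rTensor A (corFil K A n).mkQ
      (LinearMap.rTensor A (⨆ n, corFil K A n).subtype y) = 0 := by
    intro y
    induction y with
    | zero => exact ⟨0, by simp⟩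
    | tmul u b =>
      obtain ⟨n, hn⟩ := (hmem u).1 u.2
      refine ⟨n, ?_⟩
      simp [(Submodule.Quotient.mk_eq_zero _).2 hn]
    | add x y hx hy =>
      obtain ⟨n, hn⟩ := hx
      obtain ⟨m, hm⟩ := hy
      refine ⟨max n m, ?_⟩
      rw [map_add, map_add, mkQ_rTensor_mono (corFil_mono (le_max_left n m)) hn,
        mkQ_rTensor_mono (corFil_mono (le_max_right n m)) hm, add_zero]
  obtain ⟨n, hn⟩ := h2 y
  rw [hy] at hn
  have : b ∈ (⨆ n, corFil K A n) := (hmem b).2 ⟨n + 1, (mem_corFil_succ n b).2 hn⟩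
  exact hv ((Submodule.Quotient.mk_eq_zero _).2 this)

/-- Conilpotence: convolution powers of maps killing `1` are locally eventually zero. -/
def IsConil (K A : Type) [Field K] [CommRing A] [HopfAlgebra K A] : Prop :=
  ∀ a : A, ∃ N : ℕ, ∀ (R : Type) [CommRing R] [Algebra K R] (f : WithConv (A →ₗ[K] R)),
    f 1 = 0 → ∀ n, N ≤ n → (f ^ n) a = 0

theorem corFil_pow (R : Type) [CommRing R] [Algebra K R] (f : WithConv (A →ₗ[K] R))
    (hf : f 1 = 0) (n : ℕ) : ∀ a ∈ corFil K A n, (f ^ n) a = 0 := by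
  induction n with
  | zero =>
    intro a ha
    have : a = 0 := ha
    simp [this]
  | succ n ih =>
    intro a ha
    rw [mem_corFil_succ, mkQ_rTensor_eq_zero_iff] at ha
    obtain ⟨y, hy⟩ := ha
    have h2 : Coalgebra.comul (R := K) a = redComul K A a + a ⊗ₜ 1 := by simp [redComul]
    rw [pow_succ, LinearMap.convMul_apply, h2, ← hy, map_add, map_add]
    have : ∀ y, LinearMap.mul' K R (TensorProduct.map (f ^ n).ofConv f.ofConv
        (LinearMap.rTensor A (corFil K A n).subtype y)) = 0 := by
      intro y
      induction y with
      | zero => simp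
      | tmul u b => simp [ih u u.2]
      | add x y hx hy => simp only [map_add, hx, hy, add_zero]
    rw [this, zero_add]
    simp [hf]

theorem IsUnipotentHopf.isConil (hA : IsUnipotentHopf K A) : IsConil K A := by
  intro a
  obtain ⟨N, hN⟩ := exists_mem_corFil hA a
  exact ⟨N, fun R _ _ f hf n hn => corFil_pow R f hf n a (corFil_mono hn hN)⟩

end CoactionTools

section LogTools

open TensorProduct Polynomial WithConv Coalgebra

variable {K A : Type} [Field K] [CommRing A] [HopfAlgebra K A]

theorem exists_poly_of_family {R : Type} [CommRing R] [Algebra K R] (h : ℕ → A →ₗ[K] R)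
    (hfin : ∀ a, ∃ N, ∀ n, N ≤ n → h n a = 0) :
    ∃ H : A →ₗ[K] R[X], ∀ a n, (H a).coeff n = h n a := by
  choose N hN using hfin
  have key : ∀ a n, (∑ i ∈ Finset.range (N a), monomial i (h i a)).coeff n = h n a := by
    intro a n
    simp only [finsetSum_coeff, coeff_monomial, Finset.sum_ite_eq', Finset.mem_range]
    split_ifs with hn
    · rfl
    · exact (hN a n (not_lt.1 hn)).symm
  refine ⟨⟨⟨fun a => ∑ i ∈ Finset.range (N a), monomial i (h i a), ?_⟩, ?_⟩, key⟩
  · intro a b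
    ext n
    rw [coeff_add, key, key, key, map_add]
  · intro c a
    ext n
    rw [coeff_smul, key, key, map_smul, RingHom.id_apply]

theorem poly_eq_of_eval_nat [CharZero K] {B : Type} [CommRing B] [Algebra K B] {p q : B[X]}
    (h : ∀ n : ℕ, p.eval (n : B) = q.eval (n : B)) : p = q := by
  rw [← sub_eq_zero]
  have h' : ∀ n : ℕ, (p - q).eval (n : B) = 0 := by intro n; simp [h]
  generalize p - q = r at h'
  ext k
  rw [coeff_zero]
  rw [← Module.forall_dual_apply_eq_zero_iff K]
  intro l
  let s : K[X] := ∑ i ∈ Finset.range (r.natDegree + 1), monomial i (l (r.coeff i))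
  have hs : ∀ n : ℕ, s.eval (n : K) = 0 := by
    intro n
    have h1 := congrArg l (h' n)
    rw [eval_eq_sum_range, map_sum, map_zero] at h1
    simp only [s, eval_finsetSum, eval_monomial]
    rw [← h1]
    refine Finset.sum_congr rfl fun i _ => ?_
    have : r.coeff i * (n : B) ^ i = ((n : K) ^ i) • r.coeff i := by
      rw [Algebra.smul_def]; simp [mul_comm]
    rw [this, map_smul, smul_eq_mul, mul_comm]
  have hs0 : s = 0 := by
    refine eq_zero_of_infinite_isRoot s ?_
    refine (Set.infinite_range_of_injective (Nat.cast_injective (R := K))).mono ?_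
    rintro _ ⟨n, rfl⟩
    exact hs n
  have hk := congrArg (fun t => t.coeff k) hs0
  simp only [s, finsetSum_coeff, coeff_monomial, Finset.sum_ite_eq', Finset.mem_range,
    coeff_zero] at hk
  by_cases hkd : k < r.natDegree + 1
  · simpa [hkd] using hk
  · rw [coeff_eq_zero_of_natDegree_lt (by omega), map_zero]

/-- convolution powers of the identity. -/
noncomputable def adams (K A : Type) [Field K] [CommRing A] [HopfAlgebra K A] (n : ℕ) :
    A →ₐ[K] A := ((toConv (AlgHom.id K A)) ^ n).ofConv

theorem adams_eq (n : ℕ) (a : A) :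
    adams K A n a = ((toConv (LinearMap.id : A →ₗ[K] A)) ^ n) a := by
  have := AlgHom.toLinearMap_convPow (toConv (AlgHom.id K A)) n
  have h2 := congrArg (fun f => f.ofConv a) this
  exact h2

theorem exists_psi [CharZero K] (hA : IsConil K A) :
    ∃ Ψ : A →ₗ[K] A[X], ∀ a (n : ℕ), (Ψ a).eval (n : A) = adams K A n a := by
  let J : WithConv (A →ₗ[K] A) := toConv LinearMap.id - 1
  have hJ : J 1 = 0 := by simp [J]
  obtain ⟨H, hH⟩ := exists_poly_of_family (fun n => (J ^ n).ofConv) (fun a => by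
    obtain ⟨N, hN⟩ := hA a
    exact ⟨N, fun n hn => hN A J hJ n hn⟩)
  let q : ℕ → K[X] := fun j => C ((j.factorial : K)⁻¹) * descPochhammer K j
  have hq : ∀ j n : ℕ, (q j).eval (n : K) = (n.choose j : K) := by
    intro j n
    simp only [q, eval_mul, eval_C, descPochhammer_eval_eq_descFactorial]
    rw [Nat.descFactorial_eq_factorial_mul_choose, Nat.cast_mul, inv_mul_cancel_left₀]
    exact_mod_cast j.factorial_ne_zero
  let g : ℕ → A →ₗ[K] A[X] := fun j =>
    (LinearMap.mulRight K ((q j).map (algebraMap K A))) ∘ₗ (CAlgHom (R := K) (A := A)).toLinearMap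
  have hg : ∀ j c (n : ℕ), (g j c).eval (n : A) = c * (n.choose j : A) := by
    intro j c n
    have : ((n : K[X]).eval (0 : K)) = n := by simp
    simp only [g, LinearMap.comp_apply, LinearMap.mulRight_apply, AlgHom.toLinearMap_apply,
      CAlgHom_apply, eval_mul, eval_C]
    congr 1
    rw [← map_natCast (algebraMap K A) n, eval_map_algebraMap, aeval_algebraMap_apply,
      coe_aeval_eq_eval, hq, map_natCast]
  refine ⟨Polynomial.lsum g ∘ₗ H, fun a n => ?_⟩
  have h1 : (toConv (LinearMap.id : A →ₗ[K] A)) = J + 1 := by simp [J]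
  rw [adams_eq, h1, (Commute.one_right J).add_pow]
  simp only [LinearMap.comp_apply, Polynomial.lsum_apply, Polynomial.sum_def, one_pow, mul_one]
  rw [eval_finsetSum]
  simp only [hg, hH]
  have h2 : ∀ m, (J ^ m * (n.choose m : WithConv (A →ₗ[K] A))) a = (J ^ m) a * (n.choose m : A) := by
    intro m
    rw [← nsmul_eq_mul', ← nsmul_eq_mul']
    rfl
  have h3 : (∑ m ∈ Finset.range (n + 1), J ^ m * (n.choose m : WithConv (A →ₗ[K] A))) a =
      ∑ m ∈ Finset.range (n + 1), (J ^ m) a * (n.choose m : A) := by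
    rw [ofConv_sum, LinearMap.sum_apply]
    exact Finset.sum_congr rfl fun m _ => h2 m
  rw [h3]
  apply Finset.sum_congr_of_eq_on_inter
  · intro m _ hm
    have : n < m := by simpa using hm
    rw [Nat.choose_eq_zero_of_lt this]; simp
  · intro m _ hm
    rw [mem_support_iff, not_not, hH] at hm
    rw [hm, zero_mul]
  · intros; rfl

theorem adams_zero (a : A) : adams K A 0 a = algebraMap K A (counit a) := by
  simp [adams]

theorem adams_add (n m : ℕ) (a : A) {ι : Type} (r : Repr K a ι) :
    adams K A (n + m) a =
      ∑ i ∈ r.index, adams K A n (r.left i) * adams K A m (r.right i) := by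
  simp only [adams_eq]
  rw [pow_add, r.convMul_apply]

theorem comp_convPow {B C : Type} [CommRing B] [Algebra K B] [CommRing C] [Algebra K C]
    (h : B →ₐ[K] C) (f : WithConv (A →ₐ[K] B)) (n : ℕ) :
    h.comp (f ^ n).ofConv = ((toConv (h.comp f.ofConv)) ^ n).ofConv := by
  induction n with
  | zero => ext a; simp
  | succ n ih => rw [pow_succ, AlgHom.comp_convMul_distrib, ih, pow_succ]

theorem comul_adams [IsCocomm K A] (n : ℕ) (a : A) {ι : Type} (r : Repr K a ι) :
    comul (R := K) (adams K A n a) =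
      ∑ i ∈ r.index, adams K A n (r.left i) ⊗ₜ[K] adams K A n (r.right i) := by
  let i1 : A →ₐ[K] A ⊗[K] A := Algebra.TensorProduct.includeLeft
  let i2 : A →ₐ[K] A ⊗[K] A := Algebra.TensorProduct.includeRight
  have h1 : toConv (Bialgebra.comulAlgHom K A) = toConv i1 * toConv i2 := by
    apply WithConv.ext
    ext b
    rw [AlgHom.convMul_apply]
    have : Algebra.TensorProduct.lift i1 i2 (fun _ _ => .all ..) = AlgHom.id K _ := by
      ext <;> simp [i1, i2]
    simp only [ofConv_toConv]
    rw [this]; simp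
  have h2 : (Bialgebra.comulAlgHom K A).comp (adams K A n) =
      ((toConv (i1.comp (adams K A n))) * (toConv (i2.comp (adams K A n)))).ofConv := by
    simp only [adams]
    rw [comp_convPow, comp_convPow, comp_convPow]
    simp only [ofConv_toConv, AlgHom.comp_id, toConv_ofConv]
    rw [h1, mul_pow]
  have h3 := DFunLike.congr_fun h2 a
  rw [AlgHom.convMul_apply, ← r.eq] at h3
  simpa [i1, i2] using h3

theorem counit_prim {p : A} (hp : comul (R := K) p = p ⊗ₜ 1 + 1 ⊗ₜ p) :
    counit (R := K) p = 0 := by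
  have h3 := rTensor_counit_comul (R := K) p
  rw [hp] at h3
  have h4 := congrArg (fun t => counit (R := K) (TensorProduct.lid K A t)) h3
  simpa using h4

theorem exists_log [CharZero K] [IsCocomm K A] (hA : IsConil K A) : ∃ e : A →ₗ[K] A,
    (∀ a b, e (a * b) = counit (R := K) a • e b + counit (R := K) b • e a) ∧
    (∀ a, comul (R := K) (e a) = e a ⊗ₜ 1 + 1 ⊗ₜ e a) ∧
    (∀ p, comul (R := K) p = p ⊗ₜ 1 + 1 ⊗ₜ p → e p = p) ∧
    (∀ a, a ∈ Algebra.adjoin K (Set.range e)) := by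
  obtain ⟨Ψ, hΨ⟩ := exists_psi hA
  have h0 : ∀ a, (Ψ a).coeff 0 = algebraMap K A (counit a) := by
    intro a
    rw [coeff_zero_eq_eval_zero, ← adams_zero, ← hΨ]; simp
  let e : A →ₗ[K] A := (lcoeff A 1).restrictScalars K ∘ₗ Ψ
  have he : ∀ a, e a = (Ψ a).coeff 1 := fun a => rfl
  have hmul : ∀ a b, Ψ (a * b) = Ψ a * Ψ b := by
    intro a b
    apply poly_eq_of_eval_nat (K := K)
    intro n
    rw [eval_mul, hΨ, hΨ, hΨ, map_mul]
  have hcom : ∀ a, (Ψ a).map (Bialgebra.comulAlgHom K A : A →+* A ⊗[K] A) =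
      ∑ i ∈ (ℛ K a).index,
        (Ψ ((ℛ K a).left i)).map (Algebra.TensorProduct.includeLeft : A →ₐ[K] A ⊗[K] A) *
        (Ψ ((ℛ K a).right i)).map (Algebra.TensorProduct.includeRight : A →ₐ[K] A ⊗[K] A) := by
    intro a
    apply poly_eq_of_eval_nat (K := K)
    intro n
    rw [eval_finsetSum]
    simp only [eval_mul, eval_natCast_map, hΨ]
    have := comul_adams n a (ℛ K a)
    simpa using this
  have hder : ∀ a, derivative (Ψ a) =
      ∑ i ∈ (ℛ K a).index, C (e ((ℛ K a).left i)) * Ψ ((ℛ K a).right i) := by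
    intro a
    apply poly_eq_of_eval_nat (K := K)
    intro m
    have h1 : (Ψ a).comp (X + C (m : A)) = ∑ i ∈ (ℛ K a).index, Ψ ((ℛ K a).left i) *
        C ((Ψ ((ℛ K a).right i)).eval (m : A)) := by
      apply poly_eq_of_eval_nat (K := K)
      intro n
      rw [eval_finsetSum]
      simp only [eval_mul, eval_comp, eval_add, eval_X, eval_C]
      rw [← Nat.cast_add]
      simp only [hΨ]
      exact adams_add n m a _
    have h2 := congrArg (fun p => (derivative p).eval 0) h1
    simp only [derivative_comp, derivative_sum, eval_finsetSum] at h2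
    simp only [eval_finsetSum]
    simp [derivative_mul, ← coeff_zero_eq_eval_zero, coeff_derivative] at h2
    simp only [eval_mul, eval_C, he]
    exact h2
  have hrec : ∀ a k, (Ψ a).coeff (k + 1) * (k + 1) =
      ∑ i ∈ (ℛ K a).index, e ((ℛ K a).left i) * (Ψ ((ℛ K a).right i)).coeff k := by
    intro a k
    rw [← coeff_derivative, hder]
    simp
  refine ⟨e, ?_, ?_, ?_, ?_⟩
  · intro a b
    rw [he, hmul, coeff_mul, Finset.Nat.antidiagonal_succ]
    simp [h0, he, Algebra.smul_def]
    ring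
  · intro a
    have h1 := congrArg (fun p => p.coeff 1) (hcom a)
    simp only [coeff_map, finsetSum_coeff, coeff_mul, Finset.Nat.antidiagonal_succ] at h1
    simp [h0] at h1
    have hl : ∑ i ∈ (ℛ K a).index, algebraMap K A (counit ((ℛ K a).left i)) ⊗ₜ[K]
        (Ψ ((ℛ K a).right i)).coeff 1 = 1 ⊗ₜ[K] e a := by
      conv_rhs => rw [← sum_counit_smul (ℛ K a)]
      rw [map_sum, tmul_sum]
      refine Finset.sum_congr rfl fun i _ => ?_
      rw [map_smul, tmul_smul, smul_tmul', Algebra.algebraMap_eq_smul_one, he]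
    have hr : ∑ i ∈ (ℛ K a).index, (Ψ ((ℛ K a).left i)).coeff 1 ⊗ₜ[K]
        algebraMap K A (counit ((ℛ K a).right i)) = e a ⊗ₜ[K] 1 := by
      have h2 := congrArg (fun t => e (TensorProduct.rid K A t)) (sum_tmul_counit_eq (ℛ K a))
      simp only [map_sum, TensorProduct.rid_tmul, one_smul, map_smul] at h2
      rw [← h2, sum_tmul]
      refine Finset.sum_congr rfl fun i _ => ?_
      rw [Algebra.algebraMap_eq_smul_one, tmul_smul, smul_tmul', he]
    rw [he, h1, Finset.sum_add_distrib, hl, hr, he, add_comm]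
  · intro p hp
    have h1 : Ψ p = C p * X := by
      apply poly_eq_of_eval_nat (K := K)
      intro n
      rw [hΨ, eval_mul, eval_C, eval_X]
      induction n with
      | zero =>
        have h5 := counit_prim hp
        rw [adams_zero, h5]; simp
      | succ n ih =>
        have h3 : adams K A n 1 = 1 := map_one _
        rw [adams_eq] at ih h3 ⊢
        rw [pow_succ, LinearMap.convMul_apply, hp]
        simp [ih, h3, mul_add]
    rw [he, h1]; simp
  · have hk : ∀ k a, (Ψ a).coeff k ∈ Algebra.adjoin K (Set.range e) := by
      intro k
      induction k with
      | zero => intro a; rw [h0]; exact Subalgebra.algebraMap_mem _ _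
      | succ k ih =>
        intro a
        have h1 := hrec a k
        have h2 : (Ψ a).coeff (k + 1) = ((k + 1 : K)⁻¹) • ((Ψ a).coeff (k + 1) * (k + 1)) := by
          have : (Ψ a).coeff (k + 1) * (k + 1) = (k + 1 : K) • (Ψ a).coeff (k + 1) := by
            rw [Algebra.smul_def]; simp [mul_comm]
          rw [this, smul_smul, inv_mul_cancel₀ (by exact_mod_cast k.succ_ne_zero), one_smul]
        rw [h2, h1]
        refine Subalgebra.smul_mem _ (Subalgebra.sum_mem _ fun i _ => ?_) _
        exact Subalgebra.mul_mem _ (Algebra.subset_adjoin ⟨_, rfl⟩) (ih _)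
    intro a
    have h1 := hΨ a 1
    have h2 : adams K A 1 a = a := by simp [adams]
    rw [h2, Nat.cast_one, eval_eq_sum_range] at h1
    rw [← h1]
    refine Subalgebra.sum_mem _ fun i _ => ?_
    simpa using hk i a

end LogTools

section ExpTools

open TensorProduct Polynomial WithConv Coalgebra

variable {K A R : Type} [Field K] [CommRing A] [HopfAlgebra K A] [CommRing R] [Algebra K R]

theorem convPow_comp_coalgHom {C D : Type} [AddCommGroup C] [Module K C] [Coalgebra K C]
    [AddCommGroup D] [Module K D] [Coalgebra K D]
    (f : WithConv (C →ₗ[K] R)) (h : D →ₗc[K] C) (n : ℕ) :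
    (f ^ n).ofConv.comp h.toLinearMap = ((toConv (f.ofConv.comp h.toLinearMap)) ^ n).ofConv := by
  induction n with
  | zero => ext a; simp
  | succ n ih => rw [pow_succ, LinearMap.convMul_comp_coalgHom_distrib, ih, pow_succ]

/-- External product of two functionals. -/
noncomputable def extProd (f g : WithConv (A →ₗ[K] R)) : WithConv (A ⊗[K] A →ₗ[K] R) :=
  toConv ((Algebra.TensorProduct.lmul' K (S := R)).toLinearMap ∘ₗ
    TensorProduct.map f.ofConv g.ofConv)

theorem extProd_apply (f g : WithConv (A →ₗ[K] R)) (a b : A) :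
    extProd f g (a ⊗ₜ b) = f a * g b := by simp [extProd]

theorem extProd_mul (f g h k : WithConv (A →ₗ[K] R)) :
    extProd f g * extProd h k = extProd (f * h) (g * k) := by
  have h1 := LinearMap.algHom_comp_convMul_distrib (Algebra.TensorProduct.lmul' K (S := R))
    (toConv (TensorProduct.map f.ofConv g.ofConv)) (toConv (TensorProduct.map h.ofConv k.ofConv))
  rw [TensorProduct.map_convMul_map] at h1
  apply WithConv.ext
  exact h1.symm

theorem extProd_one : extProd (1 : WithConv (A →ₗ[K] R)) 1 = 1 := by
  apply WithConv.ext
  ext a b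
  simp [extProd, mul_comm]

theorem extProd_pow (f g : WithConv (A →ₗ[K] R)) (n : ℕ) :
    extProd f g ^ n = extProd (f ^ n) (g ^ n) := by
  induction n with
  | zero => simp [extProd_one]
  | succ n ih => rw [pow_succ, ih, extProd_mul, pow_succ, pow_succ]

theorem convPow_mul (g : A →ₗ[K] R)
    (hg : ∀ a b, g (a * b) = counit (R := K) a • g b + counit (R := K) b • g a) (n : ℕ) (a b : A) :
    (toConv g ^ n) (a * b) =
      ∑ m ∈ Finset.HasAntidiagonal.antidiagonal n, n.choose m.1 • ((toConv g ^ m.1) a * (toConv g ^ m.2) b) := by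
  let μ : A ⊗[K] A →ₗc[K] A := (Bialgebra.mulBialgHom K A : A ⊗[K] A →ₗc[K] A)
  have hμ : ∀ a b, μ (a ⊗ₜ b) = a * b := fun a b => by simp [μ]
  have h1 : toConv ((toConv g).ofConv.comp μ.toLinearMap) =
      extProd (toConv g) 1 + extProd 1 (toConv g) := by
    apply WithConv.ext
    ext a b
    have := hμ a b
    simp [extProd, Algebra.smul_def] at this ⊢
    rw [this, hg, Algebra.smul_def, Algebra.smul_def]
    ring
  have h2 := LinearMap.congr_fun (convPow_comp_coalgHom (toConv g) μ n) (a ⊗ₜ b)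
  have hcomm : Commute (extProd (toConv g) (1 : WithConv (A →ₗ[K] R))) (extProd 1 (toConv g)) := by
    show _ * _ = _ * _
    rw [extProd_mul, extProd_mul]; simp
  rw [h1, hcomm.add_pow'] at h2
  have h3 : (toConv g ^ n).ofConv (a * b) = (toConv g ^ n).ofConv (μ (a ⊗ₜ b)) := by rw [hμ]
  rw [h3]
  refine h2.trans ?_
  rw [ofConv_sum, LinearMap.sum_apply]
  refine Finset.sum_congr rfl fun m _ => ?_
  rw [extProd_pow, extProd_pow, extProd_mul, one_pow, one_pow, one_mul, mul_one, ← extProd_apply]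
  rfl

theorem convPow_one (f : WithConv (A →ₗ[K] R)) (n : ℕ) : (f ^ n) 1 = (f 1) ^ n := by
  induction n with
  | zero => simp
  | succ n ih => rw [pow_succ, LinearMap.convMul_apply, Bialgebra.comul_one,
      Algebra.TensorProduct.one_def, TensorProduct.map_tmul, LinearMap.mul'_apply, ih, pow_succ]

theorem exists_exp [CharZero K] (hA : IsConil K A) (g : A →ₗ[K] R)
    (hg : ∀ a b, g (a * b) = counit (R := K) a • g b + counit (R := K) b • g a) :
    ∃ φ : A →ₐ[K] R, ∀ p, comul (R := K) p = p ⊗ₜ 1 + 1 ⊗ₜ p → φ p = g p := by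
  have hg1 : g 1 = 0 := by
    have := hg 1 1
    simpa using this
  obtain ⟨H, hH⟩ := exists_poly_of_family
    (fun n => ((n.factorial : K)⁻¹) • (toConv g ^ n).ofConv) (fun a => by
    obtain ⟨N, hN⟩ := hA a
    refine ⟨N, fun n hn => ?_⟩
    rw [LinearMap.smul_apply, hN R (toConv g) hg1 n hn, smul_zero])
  have hone : H 1 = 1 := by
    ext n
    rw [hH, LinearMap.smul_apply, convPow_one, coeff_one]
    cases n with
    | zero => simp
    | succ n => simp [hg1]
  have hmul : ∀ a b, H (a * b) = H a * H b := by
    intro a b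
    ext n
    rw [hH, coeff_mul, LinearMap.smul_apply, convPow_mul g hg, Finset.smul_sum]
    refine Finset.sum_congr rfl fun m hm => ?_
    rw [hH, hH, LinearMap.smul_apply, LinearMap.smul_apply, smul_mul_smul_comm,
      ← Nat.cast_smul_eq_nsmul K, smul_smul]
    congr 1
    rw [Finset.HasAntidiagonal.mem_antidiagonal] at hm
    subst hm
    rw [Nat.cast_add_choose]
    have h1 : ((m.1 + m.2).factorial : K) ≠ 0 := by exact_mod_cast (Nat.factorial_ne_zero _)
    have h2 : (m.1.factorial : K) ≠ 0 := by exact_mod_cast (Nat.factorial_ne_zero _)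
    have h3 : (m.2.factorial : K) ≠ 0 := by exact_mod_cast (Nat.factorial_ne_zero _)
    field_simp
  refine ⟨AlgHom.ofLinearMap ((Polynomial.leval (1 : R)).restrictScalars K ∘ₗ H) ?_ ?_, ?_⟩
  · simp [hone]
  · intro a b
    simp [hmul]
  · intro p hp
    have hsucc : ∀ m, (toConv g ^ (m + 1)) p = (g 1) ^ m * g p := by
      intro m
      rw [pow_succ, LinearMap.convMul_apply, hp, map_add, TensorProduct.map_tmul,
        TensorProduct.map_tmul, map_add, LinearMap.mul'_apply, LinearMap.mul'_apply, convPow_one]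
      simp [hg1]
    have h1 : H p = C (g p) * X := by
      ext n
      rw [hH, LinearMap.smul_apply]
      rcases n with _ | _ | n
      · simp [counit_prim hp]
      · rw [hsucc]; simp
      · rw [hsucc]; simp [hg1, coeff_X]
    simp [h1]

/-- The primitive elements. -/
noncomputable def primSub (K A : Type) [Field K] [CommRing A] [HopfAlgebra K A] :
    Submodule K A :=
  LinearMap.ker ((comul : A →ₗ[K] A ⊗[K] A) -
    ((TensorProduct.mk K A A).flip 1 + TensorProduct.mk K A A 1))

theorem mem_primSub {p : A} : p ∈ primSub K A ↔ comul (R := K) p = p ⊗ₜ 1 + 1 ⊗ₜ p := by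
  simp [primSub, sub_eq_zero]

theorem convMul_prim (φ ψ : A →ₐ[K] R) (p : A) (hp : p ∈ primSub K A) :
    convMul K A R φ ψ p = φ p + ψ p := by
  rw [mem_primSub] at hp
  simp [convMul, hp]

theorem restrict_bijective [CharZero K] [IsCocomm K A] (hA : IsConil K A) :
    Function.Bijective (fun φ : A →ₐ[K] R => φ.toLinearMap ∘ₗ (primSub K A).subtype) := by
  obtain ⟨e, he1, he2, he3, he4⟩ := exists_log hA
  constructor
  · intro φ ψ h
    have hle : Algebra.adjoin K (Set.range e) ≤ AlgHom.equalizer φ ψ := by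
      rw [Algebra.adjoin_le_iff]
      rintro _ ⟨a, rfl⟩
      exact LinearMap.congr_fun h ⟨e a, mem_primSub.2 (he2 a)⟩
    ext a
    exact hle (he4 a)
  · intro l
    let e' : A →ₗ[K] primSub K A := e.codRestrict _ (fun a => mem_primSub.2 (he2 a))
    obtain ⟨φ, hφ⟩ := exists_exp hA (l ∘ₗ e') (by
      intro a b
      have : e' (a * b) = counit (R := K) a • e' b + counit (R := K) b • e' a :=
        Subtype.ext (he1 a b)
      simp [this])
    refine ⟨φ, ?_⟩
    ext p
    have hp := mem_primSub.1 p.2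
    have h1 : e' p = p := Subtype.ext (he3 p hp)
    simp [hφ p hp, h1]

theorem primSub_finite [CharZero K] [IsCocomm K A] (hA : IsConil K A)
    (hfin : Algebra.FiniteType K A) : FiniteDimensional K (primSub K A) := by
  obtain ⟨e, he1, he2, he3, he4⟩ := exists_log hA
  obtain ⟨S, hS⟩ := hfin.out
  have he10 : e 1 = 0 := by simpa using he1 1 1
  have h1 : ∀ a ∈ Algebra.adjoin K (S : Set A), e a ∈ Submodule.span K (e '' (S : Set A)) := by
    intro a ha
    induction ha using Algebra.adjoin_induction with
    | mem x hx => exact Submodule.subset_span ⟨x, hx, rfl⟩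
    | algebraMap r => rw [Algebra.algebraMap_eq_smul_one, map_smul, he10, smul_zero]; exact zero_mem _
    | add x y _ _ hx hy => rw [map_add]; exact add_mem hx hy
    | mul x y _ _ hx hy =>
      rw [he1]; exact add_mem (Submodule.smul_mem _ _ hy) (Submodule.smul_mem _ _ hx)
  have h2 : primSub K A ≤ Submodule.span K (e '' (S : Set A)) := by
    intro p hp
    rw [← he3 p (mem_primSub.1 hp)]
    exact h1 p (by rw [hS]; trivial)
  have : FiniteDimensional K (Submodule.span K (e '' (S : Set A))) :=
    FiniteDimensional.span_of_finite K (S.finite_toSet.image e)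
  exact Submodule.finiteDimensional_of_le h2

end ExpTools

/-- Over a field `K` of characteristic zero:
(1) every commutative (i.e. cocommutative Hopf algebra) unipotent algebraic group is
isomorphic to a finite power `G_a^m` of the additive group, as a group-valued functor on
commutative `K`-algebras; and
(2) every commutative pro-unipotent affine group scheme (a directed union of finitely
generated unipotent Hopf subalgebras) is, as a group-valued functor, of the form
`R ↦ Hom_K(V, R)` for some `K`-vector space `V`. -/
theorem stmt_9 (K : Type) [Field K] [CharZero K] :
    (∀ (A : Type) [CommRing A] [HopfAlgebra K A],
      ((TensorProduct.comm K A A).toLinearMap ∘ₗ (Coalgebra.comul : A →ₗ[K] A ⊗[K] A)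
          = (Coalgebra.comul : A →ₗ[K] A ⊗[K] A)) →
      Algebra.FiniteType K A → IsUnipotentHopf K A →
      Nonempty (GaPowerModel K A)) ∧
    (∀ (A : Type) [CommRing A] [HopfAlgebra K A],
      ((TensorProduct.comm K A A).toLinearMap ∘ₗ (Coalgebra.comul : A →ₗ[K] A ⊗[K] A)
          = (Coalgebra.comul : A →ₗ[K] A ⊗[K] A)) →
      ∀ (ι : Type) [Preorder ι] [IsDirected ι (· ≤ ·)]
        (F : ι → Type) [∀ i, CommRing (F i)] [∀ i, HopfAlgebra K (F i)]
        (f : ∀ i, F i →ₐc[K] A),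
        (∀ i, Function.Injective ⇑(f i)) →
        (∀ i, Algebra.FiniteType K (F i)) →
        (∀ i, IsUnipotentHopf K (F i)) →
        (∀ i j, i ≤ j → Set.range ⇑(f i) ⊆ Set.range ⇑(f j)) →
        (∀ a : A, ∃ i, a ∈ Set.range ⇑(f i)) →
        Nonempty (AdditivePointsModel K A)) := by
  constructor
  · intro A _ _ hcomm hfin huni
    have : Coalgebra.IsCocomm K A := ⟨hcomm⟩
    have hA := huni.isConil
    have hP := primSub_finite hA hfin
    let b : primSub K A ≃ₗ[K] (Fin (Module.finrank K (primSub K A)) → K) :=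
      (Module.finBasis K (primSub K A)).equivFun
    exact ⟨{
      m := Module.finrank K (primSub K A)
      e := fun R _ _ => (Equiv.ofBijective _ (restrict_bijective (R := R) hA)).trans
        (b.arrowCongr (LinearEquiv.refl K R)).toEquiv
      additive := by
        intro R _ _ φ ψ
        ext x
        exact convMul_prim φ ψ _ (b.symm _).2
      natural := by
        intro R R' _ _ _ _ g φ
        ext x
        rfl }⟩
  · intro A _ _ hcomm ι _ _ F _ _ f _ _ huni _ hsurj
    have : Coalgebra.IsCocomm K A := ⟨hcomm⟩
    have hA : IsConil K A := by
      intro a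
      obtain ⟨i, b, rfl⟩ := hsurj a
      obtain ⟨N, hN⟩ := (huni i).isConil b
      refine ⟨N, fun R _ _ g hg n hn => ?_⟩
      have h1 := LinearMap.congr_fun (convPow_comp_coalgHom g (f i : F i →ₗc[K] A) n) b
      refine h1.trans (hN R _ ?_ n hn)
      have h2 : (f i) 1 = 1 := map_one _
      show g.ofConv ((f i) 1) = 0
      rw [h2, hg]
    exact ⟨{
      V := primSub K A
      e := fun R _ _ => Equiv.ofBijective _ (restrict_bijective (R := R) hA)
      additive := by
        intro R _ _ φ ψ
        ext x
        exact convMul_prim φ ψ _ x.2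
      natural := by
        intro R R' _ _ _ _ g φ
        ext x
        rfl }⟩
end
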